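/- Fix n ≥ 1 and a complex vector space V. For any family (φ_σ)_{σ∈OP_n} of elements of V, define K_π = ∑_{σ: σ ≤ π} μ̃(σ,π) φ_σ for each π ∈ OP_n. Then for every π ∈ OP_n one has φ_π = ∑_{σ: σ ≤ π} ζ̃(σ,π) K_σ. -/

import Mathlib

open Finset

namespace OSPpaper

/-- A *block* is a subset of `[n] = Fin n`. -/
abbrev Block (n : ℕ) := Finset (Fin n)

/-- `l` is an ordered set partition of the ground set `E ⊆ [n]`:
a finite sequence of pairwise disjoint nonempty subsets of `E` whose union is `E`. -/
def IsOSP {n : ℕ} (E : Finset (Fin n)) (l : List (Block n)) : Prop :=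
  (∀ P ∈ l, P.Nonempty) ∧ l.Pairwise (fun P Q => Disjoint P Q) ∧
    (∀ P ∈ l, P ⊆ E) ∧ ∀ i ∈ E, ∃ P ∈ l, i ∈ P

/-- Union of a list of blocks. -/
def unionList {n : ℕ} (l : List (Block n)) : Block n := l.foldr (· ∪ ·) ∅

/-- The order on ordered set partitions: `π ≤ σ` iff every block of `σ` is the union
of a contiguous run of blocks of `π` (runs taken in order). -/
def OSPle {n : ℕ} (π σ : List (Block n)) : Prop :=
  ∃ L : List (List (Block n)), L.flatten = π ∧ σ = L.map unionList

/-- The restriction `σ⌋_P`: intersect every block with `P` and delete the empty intersections. -/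
def restrict {n : ℕ} (σ : List (Block n)) (P : Block n) : List (Block n) :=
  (σ.map (fun Q => Q ∩ P)).filter (fun Q => decide (Q ≠ ∅))

/-- The quasi-meet `π ⋏ σ`: the concatenation `σ⌋_{P₁} σ⌋_{P₂} ⋯ σ⌋_{P_p}`. -/
def qmeet {n : ℕ} (π σ : List (Block n)) : List (Block n) :=
  (π.map (fun P => restrict σ P)).flatten

/-- Refinement: every block of `σ` is contained in some block of `τ`.
(As a relation on the underlying unordered partitions, this is the refinement order;
in particular `refines τ η` says `τ̄ ≤ η̄`.) -/
def refines {n : ℕ} (σ τ : List (Block n)) : Prop := ∀ P ∈ σ, ∃ Q ∈ τ, P ⊆ Q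

/-- An interval partition of `[m]`, with its blocks listed in (the unique) increasing order:
an ordered set partition whose consecutive blocks are completely ordered. -/
def IsIP {m : ℕ} (l : List (Finset (Fin m))) : Prop :=
  IsOSP Finset.univ l ∧ l.Chain' (fun P Q => ∀ a ∈ P, ∀ b ∈ Q, a < b)

/-- The (0-based) index `π(k)` of the block of `π` containing `k`. -/
def blockIdx {n : ℕ} (π : List (Block n)) (k : Fin n) : ℕ :=
  π.findIdx (fun P => decide (k ∈ P))

/-- The ordered kernel `κ(i₁,…,iₙ)` of a tuple: the nonempty level sets of the tuple,
listed in increasing order of the value. -/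
def kernel {n : ℕ} (i : Fin n → ℕ) : List (Block n) :=
  ((Finset.image i Finset.univ).sort (· ≤ ·)).map
    (fun v => Finset.univ.filter (fun k => i k = v))

/-- `[σ:π] = ∏_{P ∈ π} #(σ⌋_P)`. -/
def colonNum {n : ℕ} (σ π : List (Block n)) : ℕ :=
  (π.map (fun P => (restrict σ P).length)).prod

/-- `[σ:π]! = ∏_{P ∈ π} #(σ⌋_P)!`. -/
def colonFac {n : ℕ} (σ π : List (Block n)) : ℕ :=
  (π.map (fun P => Nat.factorial (restrict σ P).length)).prod

/-- For `τ̄ ≤ η̄` the sequence `(m_1,…,m_s)`: `m_i` is the (0-based) index of the block of `η`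
containing the `i`-th block of `τ`. -/
def mseq {n : ℕ} (τ η : List (Block n)) : List ℕ :=
  τ.map (fun T => η.findIdx (fun E => decide (T ⊆ E)))

/-- number of ascents of a sequence -/
def ascL (l : List ℕ) : ℕ := ((l.zip l.tail).filter (fun p => decide (p.1 < p.2))).length
/-- number of descents of a sequence -/
def desL (l : List ℕ) : ℕ := ((l.zip l.tail).filter (fun p => decide (p.2 < p.1))).length
/-- number of plateaux of a sequence -/
def platL (l : List ℕ) : ℕ := ((l.zip l.tail).filter (fun p => decide (p.1 = p.2))).length

/-- `asc_η(τ)` -/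
def ascN {n : ℕ} (τ η : List (Block n)) : ℕ := ascL (mseq τ η)
/-- `des_η(τ)` -/
def desN {n : ℕ} (τ η : List (Block n)) : ℕ := desL (mseq τ η)
/-- `plat_η(τ)` -/
def platN {n : ℕ} (τ η : List (Block n)) : ℕ := platL (mseq τ η)

/-- lengths of the maximal ascending runs of a sequence -/
def ascRunLengths (l : List ℕ) : List ℕ :=
  (l.splitBy (fun a b => decide (a < b))).map List.length
/-- lengths of the maximal level (constant) runs of a sequence -/
def levelRunLengths (l : List ℕ) : List ℕ :=
  (l.splitBy (fun a b => decide (a = b))).map List.length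

/-- `μ̃(σ,π) = (−1)^{|σ|−|π|} / [σ:π]` (real-valued). -/
noncomputable def muR {n : ℕ} (σ π : List (Block n)) : ℝ :=
  (-1 : ℝ) ^ (σ.length - π.length) / (colonNum σ π : ℝ)

/-- `ζ̃(σ,π) = 1 / [σ:π]!` (real-valued). -/
noncomputable def zetaR {n : ℕ} (σ π : List (Block n)) : ℝ :=
  1 / (colonFac σ π : ℝ)

/-- The Weisner coefficient `w(τ,η) = ∑_{σ ⋏ η = τ} μ̃(σ, 1̂ₙ)`. -/
noncomputable def wcoef {n : ℕ} (τ η : List (Block n)) : ℝ :=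
  ∑ᶠ σ ∈ {σ : List (Block n) | IsOSP Finset.univ σ ∧ qmeet σ η = τ},
    muR σ [(Finset.univ : Block n)]

/-- The Goldberg coefficient `g(τ,η) = ∑_{σ ≥ τ} ζ̃(τ,σ) w(σ,η)`. -/
noncomputable def gcoef {n : ℕ} (τ η : List (Block n)) : ℝ :=
  ∑ᶠ σ ∈ {σ : List (Block n) | IsOSP Finset.univ σ ∧ OSPle τ σ}, zetaR τ σ * wcoef σ η


/-- `μ̃(σ,π) = (−1)^{|σ|−|π|} / [σ:π]` (complex-valued). -/
noncomputable def muC {n : ℕ} (σ π : List (Block n)) : ℂ :=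
  (-1 : ℂ) ^ (σ.length - π.length) / (colonNum σ π : ℂ)

/-- `ζ̃(σ,π) = 1 / [σ:π]!` (complex-valued). -/
noncomputable def zetaC {n : ℕ} (σ π : List (Block n)) : ℂ :=
  1 / (colonFac σ π : ℂ)

open PowerSeries in
/-- The Mercator series `log (1 + X)`. -/
noncomputable def mercator : PowerSeries ℂ := .mk fun m => (-1 : ℂ) ^ (m - 1) / m

open PowerSeries in
lemma one_add_X_mul_derivative_mercator :
    (1 + X) * PowerSeries.derivative ℂ mercator = 1 := by
  have h : ∀ m, coeff m (PowerSeries.derivative ℂ mercator) = (-1 : ℂ) ^ m := fun m => by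
    have : (m : ℂ) + 1 ≠ 0 := by exact_mod_cast m.succ_ne_zero
    simp [mercator, coeff_derivative, this]
  ext m
  cases m with
  | zero => simpa [add_mul] using h 0
  | succ m => simp [add_mul, coeff_succ_X_mul, h, coeff_one, pow_succ]

open PowerSeries in
/-- The truncation `∑_{k ≤ N} log (1 + X) ^ k / k!` of `exp (log (1 + X))`. -/
noncomputable def expMercator (N : ℕ) : PowerSeries ℂ :=
  ∑ k ∈ range (N + 1), ((k.factorial : ℂ)⁻¹) • mercator ^ k

open PowerSeries in
lemma one_add_X_mul_derivative_expMercator (N : ℕ) :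
    (1 + X) * PowerSeries.derivative ℂ (expMercator (N + 1)) = expMercator N := by
  rw [expMercator, sum_range_succ', map_add, map_sum, expMercator, mul_add, mul_sum]
  simp only [Derivation.map_smul, Derivation.leibniz_pow, pow_zero, Derivation.map_one_eq_zero,
    smul_zero, mul_zero, add_zero, Nat.add_sub_cancel]
  refine sum_congr rfl fun k _ => ?_
  have hk : (k : ℂ) + 1 ≠ 0 := by exact_mod_cast k.succ_ne_zero
  have hf : (((k + 1).factorial : ℂ)⁻¹) * ((k + 1 : ℕ) : ℂ) = (k.factorial : ℂ)⁻¹ := by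
    rw [Nat.factorial_succ]
    push_cast
    field_simp
  rw [← Nat.cast_smul_eq_nsmul ℂ, smul_smul, hf, mul_smul_comm, smul_eq_mul, mul_left_comm,
    one_add_X_mul_derivative_mercator, mul_one]

open PowerSeries in
lemma coeff_expMercator (m N : ℕ) (h : m ≤ N) :
    coeff m (expMercator N) = if m ≤ 1 then 1 else 0 := by
  induction m generalizing N with
  | zero =>
    have h0 : constantCoeff mercator = 0 := by
      simp [mercator, ← coeff_zero_eq_constantCoeff_apply]
    simp [expMercator, sum_range_succ', h0]
  | succ m ih =>
    obtain ⟨N, rfl⟩ : ∃ N', N = N' + 1 := ⟨N - 1, by omega⟩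
    have key := congrArg (coeff m) (one_add_X_mul_derivative_expMercator N)
    rw [ih N (by omega)] at key
    cases m with
    | zero =>
      rw [add_mul, one_mul, map_add, coeff_zero_X_mul, coeff_derivative] at key
      simpa using key
    | succ m =>
      rw [add_mul, one_mul, map_add, coeff_succ_X_mul, coeff_derivative, coeff_derivative,
        ih (N + 1) (by omega)] at key
      have hm : (m : ℂ) + 1 + 1 ≠ 0 := by exact_mod_cast (m + 1).succ_ne_zero
      rcases Nat.eq_zero_or_pos m with rfl | hp
      · simpa using key
      · have : ¬ m + 1 ≤ 1 := by omega
        have h2 : ¬ m + 1 + 1 ≤ 1 := by omega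
        simp only [this, h2, if_false] at key ⊢
        push_cast at key
        simpa [hm] using key

section Factorizations

variable {α : Type*}

open Classical in
/-- The factorizations of a list into `k` (possibly empty) consecutive pieces. -/
noncomputable def cuts : ℕ → List α → Finset (List (List α))
  | 0, l => if l = [] then {[]} else ∅
  | k + 1, l => (antidiagonal l.length).biUnion fun p =>
      (cuts k (l.drop p.1)).image (l.take p.1 :: ·)

lemma mem_cuts {k : ℕ} {l : List α} {M : List (List α)} :
    M ∈ cuts k l ↔ M.flatten = l ∧ M.length = k := by
  induction k generalizing l M with
  | zero =>
    by_cases hl : l = []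
    · subst hl
      simp only [cuts, if_true, mem_singleton, List.length_eq_zero_iff]
      exact ⟨fun h => by simp [h], fun h => h.2⟩
    · simp only [cuts, hl, if_false, notMem_empty, false_iff, List.length_eq_zero_iff]
      rintro ⟨h, rfl⟩
      exact hl h.symm
  | succ k ih =>
    simp only [cuts, mem_biUnion, HasAntidiagonal.mem_antidiagonal, mem_image, ih]
    constructor
    · rintro ⟨p, -, M, ⟨hM, hk⟩, rfl⟩
      simp [hM, hk]
    · rintro ⟨rfl, hk⟩
      cases M with
      | nil => simp at hk
      | cons x M =>
        exact ⟨(x.length, M.flatten.length), by simp, M, by simpa using hk, by simp⟩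

lemma sum_cuts (k : ℕ) (l : List α) (f : PowerSeries ℂ) :
    ∑ M ∈ cuts k l, (M.map fun x => PowerSeries.coeff x.length f).prod =
      PowerSeries.coeff l.length (f ^ k) := by
  classical
  induction k generalizing l with
  | zero => by_cases hl : l = [] <;> simp [cuts, hl, PowerSeries.coeff_one]
  | succ k ih =>
    rw [cuts, sum_biUnion, pow_succ', PowerSeries.coeff_mul]
    · refine sum_congr rfl fun p hp => ?_
      rw [HasAntidiagonal.mem_antidiagonal] at hp
      rw [sum_image fun _ _ _ _ h => (List.cons.inj h).2]
      simp only [List.map_cons, List.prod_cons, ← mul_sum, ih, List.length_take, List.length_drop]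
      congr 3 <;> omega
    · intro p hp q hq hpq
      rw [Function.onFun, Finset.disjoint_left]
      intro M hM hM'
      simp only [mem_image, mem_coe, HasAntidiagonal.mem_antidiagonal] at hp hq hM hM'
      obtain ⟨_, -, rfl⟩ := hM
      obtain ⟨_, -, h⟩ := hM'
      have := congrArg List.length (List.cons.inj h).1
      simp only [List.length_take] at this
      exact hpq (Prod.ext (by omega) (by omega))

open Classical in
/-- The factorizations of a list into nonempty consecutive pieces. -/
noncomputable def factorizations (l : List α) : Finset (List (List α)) :=
  ((range (l.length + 1)).biUnion fun k => cuts k l).filter fun M => [] ∉ M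

lemma length_le_length_flatten {L : List (List α)} (h : [] ∉ L) :
    L.length ≤ L.flatten.length := by
  induction L with
  | nil => simp
  | cons x L ih =>
    simp only [List.mem_cons, not_or] at h
    have := List.length_pos_iff.mpr (Ne.symm h.1)
    have := ih h.2
    simp only [List.length_cons, List.flatten_cons, List.length_append]
    omega

lemma mem_factorizations {l : List α} {M : List (List α)} :
    M ∈ factorizations l ↔ M.flatten = l ∧ [] ∉ M := by
  simp only [factorizations, mem_filter, mem_biUnion, mem_range, mem_cuts]
  constructor
  · rintro ⟨⟨k, -, h, -⟩, h'⟩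
    exact ⟨h, h'⟩
  · rintro ⟨rfl, h⟩
    exact ⟨⟨_, by have := length_le_length_flatten h; omega, rfl, rfl⟩, h⟩

/-- The product of the coefficients of `log (1 + X)` at the sizes of the pieces of `M`. -/
noncomputable def mercatorWeight (M : List (List α)) : ℂ :=
  (M.map fun x => PowerSeries.coeff x.length mercator).prod

lemma sum_factorizations (l : List α) :
    ∑ M ∈ factorizations l, (M.length.factorial : ℂ)⁻¹ * mercatorWeight M =
      if l.length ≤ 1 then 1 else 0 := by
  classical
  rw [factorizations, sum_filter_of_ne, sum_biUnion,
    ← coeff_expMercator l.length l.length le_rfl, expMercator, map_sum]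
  · refine sum_congr rfl fun k _ => ?_
    rw [PowerSeries.coeff_smul, ← sum_cuts, smul_eq_mul, mul_sum]
    exact sum_congr rfl fun M hM => by rw [(mem_cuts.mp hM).2, mercatorWeight]
  · intro j _ k _ hjk
    rw [Function.onFun, Finset.disjoint_left]
    intro M hM hM'
    exact hjk ((mem_cuts.mp hM).2.symm.trans (mem_cuts.mp hM').2)
  · intro M _ hM hmem
    refine hM (mul_eq_zero_of_right _ (List.prod_eq_zero (List.mem_map.mpr ⟨[], hmem, ?_⟩)))
    simp [mercator]

open Classical in
/-- The lists obtained by factorizing each entry of `L` into nonempty consecutive pieces. -/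
noncomputable def refinements : List (List α) → Finset (List (List (List α)))
  | [] => {[]}
  | l :: L => (factorizations l ×ˢ refinements L).image fun p => p.1 :: p.2

lemma mem_refinements {L : List (List α)} {N : List (List (List α))} :
    N ∈ refinements L ↔ N.map List.flatten = L ∧ ∀ M ∈ N, [] ∉ M := by
  induction L generalizing N with
  | nil =>
    simp only [refinements, mem_singleton, List.map_eq_nil_iff]
    exact ⟨fun h => by simp [h], fun h => h.1⟩
  | cons l L ih =>
    simp only [refinements, mem_image, mem_product, Prod.exists, mem_factorizations, ih]
    constructor
    · rintro ⟨M, N, ⟨⟨rfl, hM⟩, rfl, hN⟩, rfl⟩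
      simpa using ⟨hM, hN⟩
    · rintro ⟨h, h'⟩
      cases N with
      | nil => simp at h
      | cons M N =>
        simp only [List.map_cons, List.cons.injEq] at h
        simp only [List.mem_cons, forall_eq_or_imp] at h'
        exact ⟨M, N, ⟨⟨h.1, h'.1⟩, h.2, h'.2⟩, rfl⟩

lemma sum_refinements (w : List (List α) → ℂ) (L : List (List α)) :
    ∑ N ∈ refinements L, (N.map w).prod =
      (L.map fun l => ∑ M ∈ factorizations l, w M).prod := by
  classical
  induction L with
  | nil => simp [refinements]
  | cons l L ih =>
    rw [refinements, sum_image fun p _ q _ h => Prod.ext (List.cons.inj h).1 (List.cons.inj h).2,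
      sum_product, List.map_cons, List.prod_cons, ← ih, sum_mul_sum]
    simp

lemma exists_of_flatten_eq_map {β : Type*} {f : β → α} {L : List β} {M : List (List α)}
    (h : M.flatten = L.map f) : ∃ N : List (List β), N.flatten = L ∧ N.map (List.map f) = M := by
  induction M generalizing L with
  | nil => exact ⟨[], by simpa using h, rfl⟩
  | cons x M ih =>
    rw [List.flatten_cons] at h
    obtain ⟨a, b, rfl, rfl, hb⟩ := List.map_eq_append_iff.mp h.symm
    obtain ⟨N, rfl, rfl⟩ := ih hb.symm
    exact ⟨a :: N, by simp, by simp⟩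

end Factorizations

section Order

variable {n : ℕ} {E : Finset (Fin n)}

lemma mem_unionList {l : List (Block n)} {i : Fin n} :
    i ∈ unionList l ↔ ∃ P ∈ l, i ∈ P := by
  induction l with
  | nil => simp [unionList]
  | cons P l ih => simpa [unionList] using or_congr_right ih

lemma unionList_flatten (L : List (List (Block n))) :
    unionList L.flatten = unionList (L.map unionList) := by
  ext i
  simp only [mem_unionList, List.mem_flatten, List.mem_map]
  constructor
  · rintro ⟨P, ⟨l, hl, hP⟩, hi⟩
    exact ⟨_, ⟨l, hl, rfl⟩, mem_unionList.mpr ⟨P, hP, hi⟩⟩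
  · rintro ⟨_, ⟨l, hl, rfl⟩, hi⟩
    obtain ⟨P, hP, hi⟩ := mem_unionList.mp hi
    exact ⟨P, ⟨l, hl, hP⟩, hi⟩

lemma unionList_singleton (P : Block n) : unionList [P] = P := by simp [unionList]

lemma eq_nil_of_unionList_append_eq {a c : List (Block n)} (hne : ∀ P ∈ c, P.Nonempty)
    (hd : (a ++ c).Pairwise fun P Q => Disjoint P Q) (h : unionList (a ++ c) = unionList a) :
    c = [] := by
  rw [List.eq_nil_iff_forall_not_mem]
  intro P hP
  obtain ⟨i, hi⟩ := hne P hP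
  have : i ∈ unionList a := h ▸ mem_unionList.mpr ⟨P, List.mem_append_right _ hP, hi⟩
  obtain ⟨Q, hQ, hi'⟩ := mem_unionList.mp this
  exact Finset.disjoint_left.mp ((List.pairwise_append.mp hd).2.2 Q hQ P hP) hi' hi

lemma eq_of_flatten_eq_of_map_unionList_eq {L L' : List (List (Block n))}
    (hne : ∀ P ∈ L.flatten, P.Nonempty) (hd : L.flatten.Pairwise fun P Q => Disjoint P Q)
    (h : L.flatten = L'.flatten) (hu : L.map unionList = L'.map unionList) : L = L' := by
  induction L generalizing L' with
  | nil => exact (List.map_eq_nil_iff.mp hu.symm).symm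
  | cons a K ih =>
    cases L' with
    | nil => simp at hu
    | cons a' K' =>
      rw [List.map_cons, List.map_cons, List.cons.injEq] at hu
      have haa : a = a' := by
        have h' := h
        rw [List.flatten_cons, List.flatten_cons, List.append_eq_append_iff] at h'
        rcases h' with ⟨c, rfl, hc⟩ | ⟨c, rfl, hc⟩
        · have hd' := hd
          rw [h, List.flatten_cons] at hd'
          rw [h] at hne
          rw [eq_nil_of_unionList_append_eq (fun P hP => hne P (by simp [hP]))
            (List.pairwise_append.mp hd').1 hu.1.symm, List.append_nil]
        · rw [List.flatten_cons] at hd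
          rw [eq_nil_of_unionList_append_eq (fun P hP => hne P (by simp [hP]))
            (List.pairwise_append.mp hd).1 hu.1, List.append_nil]
      subst haa
      rw [List.flatten_cons] at hne hd
      rw [ih (fun P hP => hne P (List.mem_append_right _ hP)) (List.pairwise_append.mp hd).2.1
        (by simpa using h) hu.2]

lemma restrict_append (a b : List (Block n)) (P : Block n) :
    restrict (a ++ b) P = restrict a P ++ restrict b P := by
  simp [restrict]

lemma restrict_eq_nil {l : List (Block n)} {P : Block n} (h : ∀ Q ∈ l, Disjoint Q P) :
    restrict l P = [] := by
  simpa [restrict, disjoint_iff_inter_eq_empty] using h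

lemma restrict_unionList_self {l : List (Block n)} (h : ∀ Q ∈ l, Q.Nonempty) :
    restrict l (unionList l) = l := by
  have : l.map (fun Q => Q ∩ unionList l) = l := by
    conv_rhs => rw [← List.map_id l]
    exact List.map_congr_left fun Q hQ =>
      inter_eq_left.mpr fun i hi => mem_unionList.mpr ⟨Q, hQ, hi⟩
  rw [restrict, this, List.filter_eq_self]
  exact fun Q hQ => by simpa using (h Q hQ).ne_empty

lemma disjoint_unionList {l : List (Block n)} {Q : Block n} (h : ∀ P ∈ l, Disjoint Q P) :
    Disjoint Q (unionList l) := by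
  rw [Finset.disjoint_left]
  intro i hi hi'
  obtain ⟨P, hP, hiP⟩ := mem_unionList.mp hi'
  exact Finset.disjoint_left.mp (h P hP) hi hiP

lemma restrict_flatten_unionList {L : List (List (Block n))} (h : IsOSP E L.flatten)
    {l : List (Block n)} (hl : l ∈ L) : restrict L.flatten (unionList l) = l := by
  obtain ⟨hne, hd, -⟩ := h
  obtain ⟨A, B, rfl⟩ := List.append_of_mem hl
  simp only [List.flatten_append, List.flatten_cons] at hne hd ⊢
  rw [List.pairwise_append, List.pairwise_append] at hd
  rw [restrict_append, restrict_append,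
    restrict_unionList_self fun Q hQ => hne Q (by simp [hQ]), restrict_eq_nil, restrict_eq_nil]
  · simp
  · exact fun Q hQ => disjoint_unionList fun P hP => (hd.2.1.2.2 P hP Q hQ).symm
  · exact fun Q hQ => disjoint_unionList fun P hP => hd.2.2 Q hQ P (List.mem_append_left _ hP)

lemma map_restrict_flatten {β : Type*} (f : ℕ → β) {L : List (List (Block n))}
    (h : IsOSP E L.flatten) :
    (L.map unionList).map (fun P => f (restrict L.flatten P).length) =
      L.map fun l => f l.length := by
  rw [List.map_map]
  exact List.map_congr_left fun l hl => by
    rw [Function.comp_apply, restrict_flatten_unionList h hl]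

lemma zetaC_flatten {L : List (List (Block n))} (h : IsOSP E L.flatten) :
    zetaC L.flatten (L.map unionList) = (L.map fun l => (l.length.factorial : ℂ)⁻¹).prod := by
  rw [zetaC, colonFac, map_restrict_flatten Nat.factorial h, Nat.cast_list_prod, one_div,
    List.prod_inv, List.map_map, List.map_map]
  rfl

lemma mercatorWeight_eq {α : Type*} {L : List (List α)} (h : [] ∉ L) :
    mercatorWeight L =
      (-1 : ℂ) ^ (L.flatten.length - L.length) / ((L.map List.length).prod : ℕ) := by
  induction L with
  | nil => simp [mercatorWeight]
  | cons l L ih =>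
    simp only [List.mem_cons, not_or] at h
    have h1 := List.length_pos_iff.mpr (Ne.symm h.1)
    have h2 := length_le_length_flatten h.2
    have h3 : (l :: L).flatten.length - (l :: L).length =
        (l.length - 1) + (L.flatten.length - L.length) := by
      simp only [List.length_cons, List.flatten_cons, List.length_append]
      omega
    have h4 : mercatorWeight (l :: L) = PowerSeries.coeff l.length mercator * mercatorWeight L :=
      List.prod_cons
    rw [h4, ih h.2, h3, mercator, PowerSeries.coeff_mk, pow_add, List.map_cons, List.prod_cons,
      Nat.cast_mul, div_mul_div_comm]

lemma muC_flatten {L : List (List (Block n))} (h : IsOSP E L.flatten) (h' : [] ∉ L) :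
    muC L.flatten (L.map unionList) = mercatorWeight L := by
  rw [muC, colonNum, map_restrict_flatten (fun k => k) h, List.length_map, mercatorWeight_eq h']

lemma IsOSP.nil_notMem {L : List (List (Block n))} (h : IsOSP E (L.map unionList)) : [] ∉ L :=
  fun hmem => not_nonempty_empty (h.1 _ (List.mem_map.mpr ⟨[], hmem, rfl⟩))

lemma IsOSP.map_unionList {L : List (List (Block n))} (h : IsOSP E L.flatten) (h' : [] ∉ L) :
    IsOSP E (L.map unionList) := by
  obtain ⟨hne, hd, hsub, hcov⟩ := h
  refine ⟨?_, ?_, ?_, ?_⟩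
  · rw [List.forall_mem_map]
    intro l hl
    obtain ⟨P, hP⟩ := List.exists_mem_of_ne_nil l fun h0 => h' (h0 ▸ hl)
    obtain ⟨i, hi⟩ := hne P (List.mem_flatten.mpr ⟨l, hl, hP⟩)
    exact ⟨i, mem_unionList.mpr ⟨P, hP, hi⟩⟩
  · rw [List.pairwise_map]
    refine (List.pairwise_flatten.mp hd).2.imp fun {a b} hab => ?_
    exact disjoint_unionList fun Q hQ =>
      (disjoint_unionList fun P hP => (hab P hP Q hQ).symm).symm
  · rw [List.forall_mem_map]
    intro l hl i hi
    obtain ⟨P, hP, hi⟩ := mem_unionList.mp hi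
    exact hsub P (List.mem_flatten.mpr ⟨l, hl, hP⟩) hi
  · intro i hi
    obtain ⟨P, hP, hiP⟩ := hcov i hi
    obtain ⟨l, hl, hPl⟩ := List.mem_flatten.mp hP
    exact ⟨_, List.mem_map.mpr ⟨l, hl, rfl⟩, mem_unionList.mpr ⟨P, hPl, hiP⟩⟩

lemma flatten_map_singleton {α : Type*} (l : List α) : (l.map fun x => [x]).flatten = l := by
  induction l with
  | nil => rfl
  | cons x l ih => simp [ih]

lemma OSPle.refl (π : List (Block n)) : OSPle π π :=
  ⟨π.map fun P => [P], flatten_map_singleton π, by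
    simp [List.map_map, Function.comp_def, unionList_singleton]⟩

lemma map_unionList_flatten (N : List (List (List (Block n)))) :
    (N.map (List.map unionList)).map unionList = (N.map List.flatten).map unionList := by
  rw [List.map_map, List.map_map]
  exact List.map_congr_left fun M _ => (unionList_flatten M).symm

/-- Pairs of consecutive coarsenings come from a single three-level nesting. -/
lemma OSPle.exists_nested {τ σ π : List (Block n)} (h : OSPle τ σ) (h' : OSPle σ π) :
    ∃ N : List (List (List (Block n))), N.flatten.flatten = τ ∧ σ = N.flatten.map unionList ∧
      π = (N.map List.flatten).map unionList := by
  obtain ⟨L, rfl, rfl⟩ := h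
  obtain ⟨M, hM, rfl⟩ := h'
  obtain ⟨N, rfl, rfl⟩ := exists_of_flatten_eq_map hM
  exact ⟨N, rfl, rfl, map_unionList_flatten N⟩

lemma OSPle.trans {τ σ π : List (Block n)} (h : OSPle τ σ) (h' : OSPle σ π) : OSPle τ π := by
  obtain ⟨N, rfl, -, rfl⟩ := h.exists_nested h'
  exact ⟨N.map List.flatten, List.flatten_flatten.symm, rfl⟩

/-- A refinement of `L` is determined by the coarsening it induces. -/
lemma injOn_refinements {L : List (List (Block n))} (hτ : IsOSP E L.flatten) :
    Set.InjOn (fun N : List (List (List (Block n))) => N.flatten.map unionList)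
      (refinements L) := by
  intro N hN N' hN' h
  obtain ⟨hN, hN0⟩ := mem_refinements.mp hN
  obtain ⟨hN', -⟩ := mem_refinements.mp hN'
  have hNf : N.flatten.flatten = L.flatten := by rw [List.flatten_flatten, hN]
  have hNf' : N'.flatten.flatten = L.flatten := by rw [List.flatten_flatten, hN']
  have hflat : N.flatten = N'.flatten :=
    eq_of_flatten_eq_of_map_unionList_eq (hNf ▸ hτ.1) (hNf ▸ hτ.2.1) (hNf.trans hNf'.symm) h
  have hnil : [] ∉ N.flatten := fun h0 => by
    obtain ⟨M, hM, h0⟩ := List.mem_flatten.mp h0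
    exact hN0 M hM h0
  have hσ : IsOSP E (N.map (List.map unionList)).flatten := by
    rw [← List.map_flatten]
    exact IsOSP.map_unionList (hNf ▸ hτ) hnil
  have hmap : N.map (List.map unionList) = N'.map (List.map unionList) :=
    eq_of_flatten_eq_of_map_unionList_eq hσ.1 hσ.2.1
      (by rw [← List.map_flatten, ← List.map_flatten, hflat])
      (by rw [map_unionList_flatten, map_unionList_flatten, hN, hN'])
  refine List.eq_iff_flatten_eq.mpr ⟨hflat, ?_⟩
  simpa [List.map_map, Function.comp_def] using congrArg (List.map List.length) hmap

lemma finite_setOf_isOSP (E : Finset (Fin n)) : {σ : List (Block n) | IsOSP E σ}.Finite := by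
  refine (List.finite_length_le (Block n) (Fintype.card (Block n))).subset fun σ hσ => ?_
  refine List.Nodup.length_le_card ?_
  refine List.nodup_iff_pairwise_ne.mpr (hσ.2.1.imp_of_mem fun {P Q} hP _ hPQ h => ?_)
  subst h
  exact (hσ.1 P hP).ne_empty (disjoint_self.mp hPQ)

/-- The ordered set partitions of `E`. -/
noncomputable def ospFinset (E : Finset (Fin n)) : Finset (List (Block n)) :=
  (finite_setOf_isOSP E).toFinset

lemma mem_ospFinset {σ : List (Block n)} : σ ∈ ospFinset E ↔ IsOSP E σ := by
  simp [ospFinset]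

open Classical in
/-- On ordered set partitions, `zetaC` and `muC` are mutually inverse. -/
lemma sum_zetaC_mul_muC {τ π : List (Block n)} (hτ : IsOSP E τ) (hπ : IsOSP E π) :
    ∑ σ ∈ ospFinset E with OSPle τ σ ∧ OSPle σ π, zetaC σ π * muC τ σ =
      if τ = π then 1 else 0 := by
  by_cases hle : OSPle τ π
  swap
  · rw [if_neg (by rintro rfl; exact hle (OSPle.refl τ)), sum_eq_zero]
    intro σ hσ
    exact absurd ((mem_filter.mp hσ).2.1.trans (mem_filter.mp hσ).2.2) hle
  obtain ⟨L, rfl, rfl⟩ := hle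
  have hL := hπ.nil_notMem
  have hN : ∀ N ∈ refinements L, N.flatten.flatten = L.flatten ∧ [] ∉ N.flatten ∧
      N.map List.flatten = L := fun N hN => by
    obtain ⟨rfl, h0⟩ := mem_refinements.mp hN
    refine ⟨List.flatten_flatten, fun hmem => ?_, rfl⟩
    obtain ⟨M, hM, hmem⟩ := List.mem_flatten.mp hmem
    exact h0 M hM hmem
  have key : ∑ N ∈ refinements L,
      (N.map fun M => (M.length.factorial : ℂ)⁻¹ * mercatorWeight M).prod =
      ∑ σ ∈ ospFinset E with OSPle L.flatten σ ∧ OSPle σ (L.map unionList),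
        zetaC σ (L.map unionList) * muC L.flatten σ := by
    refine sum_nbij (fun N => N.flatten.map unionList) ?_ (injOn_refinements hτ) ?_ ?_
    · intro N hNL
      obtain ⟨h1, h2, h3⟩ := hN N hNL
      rw [mem_filter, mem_ospFinset]
      refine ⟨IsOSP.map_unionList (h1 ▸ hτ) h2, ⟨_, h1, rfl⟩, N.map (List.map unionList), ?_, ?_⟩
      · rw [List.map_flatten]
      · rw [map_unionList_flatten, h3]
    · intro σ hσ
      rw [mem_coe, mem_filter, mem_ospFinset] at hσ
      obtain ⟨hσ, h1, h2⟩ := hσ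
      obtain ⟨N, hNf, rfl, hNπ⟩ := h1.exists_nested h2
      refine ⟨N, mem_refinements.mpr ⟨?_, fun M hM h0 => ?_⟩, rfl⟩
      · exact (eq_of_flatten_eq_of_map_unionList_eq hτ.1 hτ.2.1
          (by rw [← hNf, List.flatten_flatten]) hNπ).symm
      · exact hσ.nil_notMem (List.mem_flatten.mpr ⟨M, hM, h0⟩)
    · intro N hNL
      obtain ⟨h1, h2, h3⟩ := hN N hNL
      have hmu := muC_flatten (h1 ▸ hτ) h2
      have hσ : IsOSP E (N.map (List.map unionList)).flatten := by
        rw [← List.map_flatten]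
        exact IsOSP.map_unionList (h1 ▸ hτ) h2
      have hzeta := zetaC_flatten hσ
      rw [map_unionList_flatten, h3, ← List.map_flatten, List.map_map] at hzeta
      rw [← h1, hmu, hzeta, List.prod_map_mul]
      congr 1
      · simp [Function.comp_def]
      · rw [mercatorWeight, List.map_flatten, List.prod_flatten, List.map_map]
        rfl
  rw [← key, sum_refinements]
  simp only [sum_factorizations]
  split_ifs with h
  · have hs : L = L.flatten.map fun P => [P] :=
      eq_of_flatten_eq_of_map_unionList_eq hτ.1 hτ.2.1 (flatten_map_singleton _).symm (by
        rw [← h]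
        simp [List.map_map, Function.comp_def, unionList_singleton])
    rw [hs]
    refine List.prod_eq_one fun x hx => ?_
    simp only [List.mem_map, exists_exists_and_eq_and] at hx
    obtain ⟨P, -, rfl⟩ := hx
    simp
  · by_contra h0
    refine h ?_
    have hsingle : ∀ l ∈ L, [unionList l] = l := fun l hl => by
      have h1 : l.length ≤ 1 := by
        by_contra h1
        exact h0 (List.prod_eq_zero (List.mem_map.mpr ⟨l, hl, if_neg h1⟩))
      match l, h1 with
      | [], _ => exact absurd hl hL
      | [P], _ => rw [unionList_singleton]
    have hmap : L.map (fun l => [unionList l]) = L := by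
      simpa using List.map_congr_left (g := id) hsingle
    rw [← flatten_map_singleton (L.map unionList), List.map_map]
    exact congrArg List.flatten hmap.symm

end Order

/-- Fix `n ≥ 1` and a complex vector space `V`. For a family
`(φ_σ)_{σ∈OP_n}` of elements of `V`, define `K_π = ∑_{σ ≤ π} μ̃(σ,π) φ_σ` for each `π ∈ OP_n`.
Then `φ_π = ∑_{σ ≤ π} ζ̃(σ,π) K_σ` for every `π ∈ OP_n` (Möbius inversion). -/
theorem statement9 {n : ℕ} (hn : 1 ≤ n) {V : Type*} [AddCommGroup V] [Module ℂ V]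
    (φ K : List (Block n) → V)
    (hK : ∀ π : List (Block n), IsOSP Finset.univ π →
      K π = ∑ᶠ σ ∈ {σ : List (Block n) | IsOSP Finset.univ σ ∧ OSPle σ π}, muC σ π • φ σ) :
    ∀ π : List (Block n), IsOSP Finset.univ π →
      φ π = ∑ᶠ σ ∈ {σ : List (Block n) | IsOSP Finset.univ σ ∧ OSPle σ π}, zetaC σ π • K σ := by
  classical
  have hset : ∀ π : List (Block n), {σ : List (Block n) | IsOSP Finset.univ σ ∧ OSPle σ π} =
      ↑((ospFinset univ).filter fun σ => OSPle σ π) := fun π => by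
    ext σ
    simp [mem_ospFinset]
  intro π hπ
  rw [hset, finsum_mem_coe_finset]
  have hexp : ∀ σ ∈ (ospFinset univ).filter fun σ => OSPle σ π, zetaC σ π • K σ =
      ∑ τ ∈ (ospFinset univ).filter fun τ => OSPle τ σ, (zetaC σ π * muC τ σ) • φ τ := by
    intro σ hσ
    rw [hK σ (mem_ospFinset.mp (mem_filter.mp hσ).1), hset, finsum_mem_coe_finset, smul_sum]
    simp only [smul_smul]
  rw [sum_congr rfl hexp, sum_comm' (t' := ospFinset univ)
    (s' := fun τ => (ospFinset univ).filter fun σ => OSPle τ σ ∧ OSPle σ π)]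
  · simp only [← sum_smul]
    rw [sum_congr rfl fun τ hτ => by rw [sum_zetaC_mul_muC (mem_ospFinset.mp hτ) hπ]]
    simp [mem_ospFinset, hπ]
  · intro σ τ
    simp only [mem_filter]
    tauto

end OSPpaper
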